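/- arXiv:2510.16488 — 8 statements merged into one kernel-verified Lean document; each statement's English description precedes it below -/
import Mathlib

section
/- Let n ≥ 1 and let w₁,…,wₙ be vectors in ℝⁿ. Then the 2ⁿ points (1/2)·Σᵢ εᵢwᵢ (over all sign vectors ε ∈ {−1,1}ⁿ) all lie on the unit sphere S^{n−1} if and only if the wᵢ are pairwise orthogonal and Σᵢ ‖wᵢ‖² = 4. -/
open scoped RealInnerProductSpace

lemma aux_pyth {n : ℕ} (w : Fin n → EuclideanSpace ℝ (Fin n))
    (h : ∀ i j, i ≠ j → ⟪w i, w j⟫ = 0) (ε : Fin n → ℝ) (hε : ∀ i, ε i = 1 ∨ ε i = -1) :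
    ‖∑ i, ε i • w i‖ ^ 2 = ∑ i, ‖w i‖ ^ 2 := by
  rw [← real_inner_self_eq_norm_sq, sum_inner]
  refine Finset.sum_congr rfl fun i _ => ?_
  rw [inner_sum, Finset.sum_eq_single i]
  · rw [real_inner_smul_left, real_inner_smul_right, real_inner_self_eq_norm_sq]
    rcases hε i with h | h <;> rw [h] <;> ring
  · intro j _ hj
    rw [real_inner_smul_left, real_inner_smul_right, h i j hj.symm]
    ring
  · simp

lemma aux_norm {n : ℕ} (v : EuclideanSpace ℝ (Fin n)) :
    ‖(1 / 2 : ℝ) • v‖ = 1 ↔ ‖v‖ ^ 2 = 4 := by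
  rw [norm_smul, Real.norm_of_nonneg (by norm_num)]
  constructor
  · intro h
    have : ‖v‖ = 2 := by linarith
    rw [this]; norm_num
  · intro h
    have := norm_nonneg v
    nlinarith

lemma aux_flip {n : ℕ} (w : Fin n → EuclideanSpace ℝ (Fin n)) (ε : Fin n → ℝ) (i : Fin n) :
    ∑ k, (Function.update ε i (-ε i)) k • w k = ∑ k, ε k • w k - (2 * ε i) • w i := by
  rw [eq_sub_iff_add_eq, ← sub_eq_zero, add_sub_right_comm, ← Finset.sum_sub_distrib,
    Finset.sum_eq_single i]
  · simp only [Function.update_self]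
    module
  · intro j _ hj
    simp [Function.update_of_ne hj]
  · simp

theorem inscribed_sphere_iff_orthogonal
    (n : ℕ) (hn : 1 ≤ n) (w : Fin n → EuclideanSpace ℝ (Fin n)) :
    (∀ ε : Fin n → ℝ, (∀ i, ε i = 1 ∨ ε i = -1) →
        ‖(1 / 2 : ℝ) • ∑ i, ε i • w i‖ = 1) ↔
      ((∀ i j, i ≠ j → ⟪w i, w j⟫ = 0) ∧ ∑ i, ‖w i‖ ^ 2 = 4) := by
  simp only [aux_norm]
  constructor
  · intro H
    have hflip : ∀ ε : Fin n → ℝ, (∀ i, ε i = 1 ∨ ε i = -1) → ∀ i k,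
        Function.update ε i (-ε i) k = 1 ∨ Function.update ε i (-ε i) k = -1 := by
      intro ε hε i k
      by_cases hk : k = i
      · subst hk
        rw [Function.update_self]
        rcases hε k with h | h <;> rw [h] <;> simp
      · rw [Function.update_of_ne hk]
        exact hε k
    have key : ∀ ε : Fin n → ℝ, (∀ i, ε i = 1 ∨ ε i = -1) → ∀ i,
        ⟪∑ k, ε k • w k, w i⟫ = ε i * ‖w i‖ ^ 2 := by
      intro ε hε i
      have h1 := H ε hε
      have h2 := H _ (hflip ε hε i)
      rw [aux_flip, norm_sub_sq_real, h1, real_inner_smul_right, norm_smul, mul_pow,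
        Real.norm_eq_abs, sq_abs] at h2
      rcases hε i with h | h <;> rw [h] at h2 ⊢ <;> linarith
    have horth : ∀ i j, i ≠ j → ⟪w i, w j⟫ = 0 := by
      intro i j hij
      have h0 : ∀ k : Fin n, (fun _ => 1 : Fin n → ℝ) k = 1 ∨ (fun _ => 1 : Fin n → ℝ) k = -1 :=
        fun _ => Or.inl rfl
      have h1 := key _ h0 j
      have h2 := key _ (hflip _ h0 i) j
      rw [aux_flip, inner_sub_left, h1, real_inner_smul_left,
        Function.update_of_ne hij.symm] at h2
      linarith
    refine ⟨horth, ?_⟩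
    rw [← aux_pyth w horth (fun _ => 1) (fun _ => Or.inl rfl)]
    exact H _ (fun _ => Or.inl rfl)
  · rintro ⟨h, hs⟩ ε hε
    rw [aux_pyth w h ε hε, hs]
end

section
/- Let A be a symmetric positive definite 2×2 real matrix and let y₀ ∈ ℝ² be a unit vector. Then there exist an orthonormal basis u₁,u₂ of ℝ² and real numbers λ₁,λ₂ > 0 with λᵢ = 2·⟨uᵢ, y₀⟩ for i = 1,2, Σᵢ λᵢ² = 4, and 2·Σᵢ λᵢ·√(uᵢᵀ A uᵢ) = 4·√(tr A). -/
open Matrix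

lemma exists_isotropic (p q : ℝ) :
    ∃ a b : ℝ, a ^ 2 + b ^ 2 = 1 ∧ p * (a ^ 2 - b ^ 2) + 2 * q * a * b = 0 := by
  let f : ℝ → ℝ := fun t =>
    p * (Real.cos t ^ 2 - Real.sin t ^ 2) + 2 * q * Real.cos t * Real.sin t
  have hf : Continuous f := by fun_prop
  have h0 : f 0 = p := by simp [f]
  have h1 : f (Real.pi / 2) = -p := by simp [f]
  have : (0 : ℝ) ∈ Set.range f := by
    apply mem_range_of_exists_le_of_exists_ge hf
    · rcases le_total p 0 with h | h
      · exact ⟨0, by linarith⟩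
      · exact ⟨Real.pi / 2, by linarith⟩
    · rcases le_total p 0 with h | h
      · exact ⟨Real.pi / 2, by linarith⟩
      · exact ⟨0, by linarith⟩
  obtain ⟨t, ht⟩ := this
  exact ⟨Real.cos t, Real.sin t, Real.cos_sq_add_sin_sq t, ht⟩

lemma exists_sign (c : ℝ) (hc : c ≠ 0) : ∃ s : ℝ, s ^ 2 = 1 ∧ 0 < s * c := by
  rcases lt_or_gt_of_ne hc with h | h
  · exact ⟨-1, by norm_num, by linarith⟩
  · exact ⟨1, by norm_num, by linarith⟩

theorem planar_vertex_constrained_edge_length_attained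
    (A : Matrix (Fin 2) (Fin 2) ℝ) (hA : A.PosDef)
    (y₀ : Fin 2 → ℝ) (hy₀ : y₀ ⬝ᵥ y₀ = 1) :
    ∃ (u : Fin 2 → Fin 2 → ℝ) (lam : Fin 2 → ℝ),
      (∀ i j, u i ⬝ᵥ u j = if i = j then 1 else 0) ∧
      (∀ i, 0 < lam i) ∧
      (∀ i, lam i = 2 * (u i ⬝ᵥ y₀)) ∧
      (∑ i, lam i ^ 2 = 4) ∧
      2 * ∑ i, lam i * Real.sqrt (u i ⬝ᵥ A.mulVec (u i)) = 4 * Real.sqrt A.trace := by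
  have hsym : A 1 0 = A 0 1 := by simpa using hA.1.apply 0 1
  have hT : 0 < A.trace := hA.trace_pos
  have hpos : ∀ a b : ℝ, a ^ 2 + b ^ 2 = 1 →
      0 < A 0 0 * a ^ 2 + 2 * A 0 1 * a * b + A 1 1 * b ^ 2 := by
    intro a b hab
    have hne : (![a, b] : Fin 2 → ℝ) ≠ 0 := by
      intro h
      have ha : a = 0 := by simpa using congrFun h 0
      have hb : b = 0 := by simpa using congrFun h 1
      simp [ha, hb] at hab
    have := hA.dotProduct_mulVec_pos hne
    simp [dotProduct, mulVec, Fin.sum_univ_two, hsym] at this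
    linarith
  have hTe : A.trace = A 0 0 + A 1 1 := by simp [Matrix.trace, Fin.sum_univ_two]
  generalize A.trace = T at *
  set y := y₀ 0 with hy
  set z := y₀ 1 with hz
  have hyz : y ^ 2 + z ^ 2 = 1 := by
    simp [dotProduct, Fin.sum_univ_two] at hy₀
    linarith
  obtain ⟨a, b, hab, h⟩ := exists_isotropic (A 0 0 - T * y ^ 2) (A 0 1 - T * y * z)
  have hB : A 1 1 - T * z ^ 2 = -(A 0 0 - T * y ^ 2) := by
    linear_combination -hTe - T * hyz
  have h1 : A 0 0 * a ^ 2 + 2 * A 0 1 * a * b + A 1 1 * b ^ 2 = T * (a * y + b * z) ^ 2 := by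
    linear_combination h + b ^ 2 * hB
  have h2 : A 0 0 * (-b) ^ 2 + 2 * A 0 1 * (-b) * a + A 1 1 * a ^ 2
      = T * (-b * y + a * z) ^ 2 := by
    linear_combination -h + a ^ 2 * hB
  have hc1 : a * y + b * z ≠ 0 := by
    intro h0
    have := hpos a b hab
    rw [h1, h0] at this
    simp at this
  have hc2 : -b * y + a * z ≠ 0 := by
    intro h0
    have := hpos (-b) a (by linarith)
    rw [h2, h0] at this
    simp at this
  obtain ⟨s, hs, hs'⟩ := exists_sign _ hc1
  obtain ⟨r, hr, hr'⟩ := exists_sign _ hc2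
  have hq1 : √(![s * a, s * b] ⬝ᵥ A *ᵥ ![s * a, s * b]) = √T * (s * (a * y + b * z)) := by
    rw [← Real.sqrt_sq hs'.le, ← Real.sqrt_mul hT.le]
    congr 1
    simp [dotProduct, mulVec, Fin.sum_univ_two, hsym]
    linear_combination s ^ 2 * h1
  have hq2 : √(![r * -b, r * a] ⬝ᵥ A *ᵥ ![r * -b, r * a]) = √T * (r * (-b * y + a * z)) := by
    rw [← Real.sqrt_sq hr'.le, ← Real.sqrt_mul hT.le]
    congr 1
    simp [dotProduct, mulVec, Fin.sum_univ_two, hsym]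
    linear_combination r ^ 2 * h2
  have hsum : (s * (a * y + b * z)) ^ 2 + (r * (-b * y + a * z)) ^ 2 = 1 := by
    linear_combination (a * y + b * z) ^ 2 * hs + (-b * y + a * z) ^ 2 * hr
      + (y ^ 2 + z ^ 2) * hab + hyz
  refine ⟨![![s * a, s * b], ![r * -b, r * a]],
    ![2 * (s * (a * y + b * z)), 2 * (r * (-b * y + a * z))], ?_, ?_, ?_, ?_, ?_⟩
  · intro i j
    fin_cases i <;> fin_cases j <;> simp [dotProduct, Fin.sum_univ_two]
    · linear_combination s ^ 2 * hab + hs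
    · ring
    · ring
    · linear_combination r ^ 2 * hab + hr
  · intro i
    fin_cases i
    · show 0 < 2 * (s * (a * y + b * z))
      linarith
    · show 0 < 2 * (r * (-b * y + a * z))
      linarith
  · intro i
    fin_cases i <;> simp [dotProduct, Fin.sum_univ_two, ← hy, ← hz] <;> ring
  · rw [Fin.sum_univ_two]
    show (2 * (s * (a * y + b * z))) ^ 2 + (2 * (r * (-b * y + a * z))) ^ 2 = 4
    linear_combination 4 * hsum
  · rw [Fin.sum_univ_two]
    show 2 * (2 * (s * (a * y + b * z)) * √(![s * a, s * b] ⬝ᵥ A *ᵥ ![s * a, s * b])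
      + 2 * (r * (-b * y + a * z)) * √(![r * -b, r * a] ⬝ᵥ A *ᵥ ![r * -b, r * a])) = 4 * √T
    rw [hq1, hq2]
    linear_combination 4 * √T * hsum
end

section
/- Let n ≥ 1, let A be a symmetric positive definite n×n real matrix with inverse C := A⁻¹, let u₁,…,uₙ be an orthonormal basis of ℝⁿ, and let λ₁,…,λₙ > 0 satisfy Σᵢ λᵢ² = 4. Then 2·√(det A)·(Πⱼ λⱼ)·Σᵢ √(uᵢᵀ C uᵢ)/λᵢ ≤ 2ⁿ · n^{−(n−2)/2} · √(det A) · √(tr C). -/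
open Matrix

lemma aux_bern (k : ℕ) (m t : ℝ) (hm : 0 < m) (ht : 0 < t) :
    m ^ (k+1) + (k+1) * m ^ k * (t - m) ≤ t ^ (k+1) := by
  induction k with
  | zero => simp
  | succ k ih =>
    have h := mul_le_mul_of_nonneg_right ih ht.le
    have h2 : 0 ≤ (k+1) * m ^ k * (t - m)^2 := by positivity
    push_cast
    have e1 : t ^ (k+1+1) = t^(k+1) * t := by ring
    rw [e1]
    refine le_trans ?_ h
    have : (m ^ (k+1) + (k+1) * m ^ k * (t - m)) * t
      - (m ^ (k + 1 + 1) + ((k:ℝ) + 1 + 1) * m ^ (k + 1) * (t - m))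
      = (k+1) * m ^ k * (t - m)^2 := by ring
    linarith

lemma aux_mac (n : ℕ) : ∀ x : Fin (n+1) → ℝ, (∀ i, 0 < x i) →
    ∏ i, x i ≤ ((∑ i, x i) / (n+1)) ^ (n+1) ∧
    (∏ i, x i) * ∑ i, 1 / x i ≤ (n+1) * ((∑ i, x i) / (n+1)) ^ n := by
  induction n with
  | zero =>
    intro x hx
    have := (hx 0).ne'
    simp [this]
  | succ n ih =>
    intro x hx
    obtain ⟨h1, h2⟩ := ih (fun i => x i.succ) (fun i => hx _)
    rw [Fin.prod_univ_succ, Fin.sum_univ_succ x, Fin.sum_univ_succ (fun i => 1 / x i)]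
    have hy := hx 0
    have hs : 0 < ∑ i : Fin (n+1), x i.succ :=
      Finset.sum_pos (fun i _ => hx _) Finset.univ_nonempty
    set y := x 0
    set s := ∑ i : Fin (n+1), x i.succ
    set P := ∏ i : Fin (n+1), x i.succ
    set Q := ∑ i : Fin (n+1), 1 / x i.succ
    have hn : (0:ℝ) < n + 1 := by positivity
    have hn2 : (0:ℝ) < n + 1 + 1 := by positivity
    obtain ⟨m, hm⟩ : ∃ m, m = s / (n+1) := ⟨_, rfl⟩
    push_cast
    obtain ⟨t, ht⟩ : ∃ t, t = (y + s) / ((n:ℝ) + 1 + 1) := ⟨_, rfl⟩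
    rw [← hm] at h1 h2
    rw [← ht]
    have hm0 : 0 < m := by rw [hm]; positivity
    have ht0 : 0 < t := by rw [ht]; positivity
    have hyt : y = (n+1+1) * t - (n+1) * m := by
      rw [hm, ht]; field_simp; ring
    have b1 := aux_bern (n+1) m t hm0 ht0
    have b2 := aux_bern n m t hm0 ht0
    push_cast at b1
    constructor
    · calc y * P ≤ y * m ^ (n+1) := by gcongr
        _ = m ^ (n+1+1) + (n+1+1) * m ^ (n+1) * (t - m) := by rw [hyt]; ring
        _ ≤ _ := b1
    · calc y * P * (1 / y + Q) = P + y * (P * Q) := by field_simp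
        _ ≤ m ^ (n+1) + y * ((n+1) * m ^ n) := by gcongr
        _ = (n+1+1) * (m ^ (n+1) + (n+1) * m ^ n * (t - m)) := by rw [hyt]; ring
        _ ≤ _ := by gcongr

lemma aux_trace (n : ℕ) (C : Matrix (Fin n) (Fin n) ℝ) (u : Fin n → Fin n → ℝ)
    (hu : ∀ i j, u i ⬝ᵥ u j = if i = j then 1 else 0) :
    ∑ i, u i ⬝ᵥ C.mulVec (u i) = C.trace := by
  let U : Matrix (Fin n) (Fin n) ℝ := Matrix.of u
  have h1 : U * Uᵀ = 1 := by
    ext i j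
    rw [Matrix.one_apply, ← hu i j]
    rfl
  have h2 : Uᵀ * U = 1 := mul_eq_one_comm.mp h1
  have h3 : (U * (C * Uᵀ)).trace = C.trace := by
    rw [Matrix.trace_mul_comm, Matrix.mul_assoc, h2, Matrix.mul_one]
  rw [← h3]
  rfl

theorem facet_area_le_max
    (n : ℕ) (hn : 1 ≤ n) (A : Matrix (Fin n) (Fin n) ℝ) (hA : A.PosDef)
    (C : Matrix (Fin n) (Fin n) ℝ) (hC : C = A⁻¹)
    (u : Fin n → Fin n → ℝ)
    (hu : ∀ i j, u i ⬝ᵥ u j = if i = j then 1 else 0)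
    (lam : Fin n → ℝ) (hlam : ∀ i, 0 < lam i)
    (hsum : ∑ i, lam i ^ 2 = 4) :
    2 * Real.sqrt A.det * (∏ j, lam j) *
        ∑ i, Real.sqrt (u i ⬝ᵥ C.mulVec (u i)) / lam i ≤
      (2 : ℝ) ^ n * (n : ℝ) ^ (-(((n : ℝ) - 2) / 2)) *
        Real.sqrt A.det * Real.sqrt C.trace := by
  have hCp : C.PosDef := hC ▸ hA.inv
  have hc : ∀ i, 0 ≤ u i ⬝ᵥ C.mulVec (u i) := fun i => by
    simpa using hCp.posSemidef.dotProduct_mulVec_nonneg (u i)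
  have cs : ∑ i, Real.sqrt (u i ⬝ᵥ C.mulVec (u i)) / lam i ≤
      Real.sqrt C.trace * Real.sqrt (∑ i, 1 / lam i ^ 2) := by
    have := Real.sum_mul_le_sqrt_mul_sqrt Finset.univ
      (fun i => Real.sqrt (u i ⬝ᵥ C.mulVec (u i))) (fun i => 1 / lam i)
    simp only [Real.sq_sqrt (hc _), aux_trace n C u hu, div_pow, one_pow, mul_one_div] at this
    exact this
  have hP : 0 < ∏ j, lam j := Finset.prod_pos fun i _ => hlam i
  have key : 2 * (∏ j, lam j) * Real.sqrt (∑ i, 1 / lam i ^ 2) ≤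
      (2 : ℝ) ^ n * (n : ℝ) ^ (-(((n : ℝ) - 2) / 2)) := by
    obtain ⟨k, rfl⟩ : ∃ k, n = k + 1 := ⟨n - 1, by omega⟩
    have h := (aux_mac k (fun i => lam i ^ 2) (fun i => pow_pos (hlam i) 2)).2
    rw [hsum, Finset.prod_pow] at h
    refine (sq_le_sq₀ (by positivity) (by positivity)).mp ?_
    have hk : (0:ℝ) < ((k + 1 : ℕ) : ℝ) := by positivity
    rw [mul_pow, mul_pow, Real.sq_sqrt (Finset.sum_nonneg fun i _ => by positivity), mul_pow,
      ← Real.rpow_natCast ((_ : ℝ) ^ (_ : ℝ)) 2, ← Real.rpow_mul hk.le]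
    have e : -((((k + 1 : ℕ) : ℝ) - 2) / 2) * ((2 : ℕ) : ℝ) = 1 - (k : ℝ) := by
      push_cast; ring
    rw [e, Real.rpow_sub hk, Real.rpow_one, Real.rpow_natCast]
    calc _ = 4 * ((∏ j, lam j) ^ 2 * ∑ i, 1 / lam i ^ 2) := by ring
      _ ≤ 4 * ((k + 1) * (4 / (k + 1)) ^ k) := by gcongr
      _ = _ := by
        have : ((2:ℝ) ^ (k+1)) ^ 2 = 4 * 4 ^ k := by
          rw [← pow_mul, mul_comm, pow_mul, pow_succ]; norm_num; ring
        rw [this, div_pow]; push_cast; ring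
  calc _ ≤ 2 * Real.sqrt A.det * (∏ j, lam j) *
        (Real.sqrt C.trace * Real.sqrt (∑ i, 1 / lam i ^ 2)) := by gcongr
    _ = (2 * (∏ j, lam j) * Real.sqrt (∑ i, 1 / lam i ^ 2)) * Real.sqrt A.det *
        Real.sqrt C.trace := by ring
    _ ≤ _ := by gcongr
end

section
/- Let n ≥ 1 and let C be a symmetric n×n real matrix. Then there exists a real orthogonal n×n matrix U such that every diagonal entry of Uᵀ C U equals tr(C)/n. -/
open Matrix

theorem aux_rot {n : ℕ} (i j : Fin n) (hij : i ≠ j) (c s : ℝ) (h : c ^ 2 + s ^ 2 = 1) :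
    ∃ R : Matrix (Fin n) (Fin n) ℝ, Rᵀ * R = 1 ∧ ∀ C : Matrix (Fin n) (Fin n) ℝ,
      (Rᵀ * C * R) i i = c ^ 2 * C i i + c * s * (C i j + C j i) + s ^ 2 * C j j ∧
      ∀ k, k ≠ i → k ≠ j → (Rᵀ * C * R) k k = C k k := by
  let u : Fin n → Fin n → ℝ := fun k =>
    if k = i then c • Pi.single i 1 + s • Pi.single j 1
    else if k = j then (-s) • Pi.single i 1 + c • Pi.single j 1
    else Pi.single k 1
  have key : ∀ (C : Matrix (Fin n) (Fin n) ℝ) (k l : Fin n),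
      ((of u) * C * (of u)ᵀ) k l = u k ⬝ᵥ (C *ᵥ u l) := by
    intro C k l
    rw [Matrix.mul_assoc]
    rfl
  have hji := hij.symm
  refine ⟨(of u)ᵀ, ?_, ?_⟩
  · ext k l
    have := key 1 k l
    rw [Matrix.mul_one, Matrix.one_mulVec] at this
    rw [transpose_transpose, this]
    clear this key
    have ui : u i = c • Pi.single i 1 + s • Pi.single j 1 := by simp [u]
    have uj : u j = (-s) • Pi.single i 1 + c • Pi.single j 1 := by simp [u, hji]
    have uo : ∀ k, k ≠ i → k ≠ j → u k = Pi.single k 1 := by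
      intro k h1 h2
      simp [u, h1, h2]
    clear_value u
    rcases eq_or_ne k i with rfl | hki
    · rcases eq_or_ne l k with rfl | hli
      · simp [ui, hij, hji]
        linarith
      rcases eq_or_ne l j with rfl | hlj
      · simp [ui, uj, hij, hji]
        ring
      · simp [ui, uo l hli hlj, hli, hlj, hli.symm, hlj.symm]
    rcases eq_or_ne k j with rfl | hkj
    · rcases eq_or_ne l i with rfl | hli
      · simp [ui, uj, hij, hji]
        ring
      rcases eq_or_ne l k with rfl | hlj
      · simp [uj, hij, hji]
        linarith
      · simp [uj, uo l hli hlj, hli, hlj, hli.symm, hlj.symm]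
    rw [uo k hki hkj]
    rcases eq_or_ne l i with rfl | hli
    · simp [ui, hki, hkj]
    rcases eq_or_ne l j with rfl | hlj
    · simp [uj, hki, hkj]
    · simp [uo l hli hlj, Matrix.one_apply, Pi.single_apply, eq_comm]
  · intro C
    rw [transpose_transpose]
    refine ⟨?_, fun k hki hkj => ?_⟩
    · rw [key]
      simp [u, Matrix.mulVec_add, Matrix.mulVec_smul]
      ring
    · rw [key]
      simp [u, hki, hkj]

theorem aux_ivt (a b d m : ℝ) (h1 : a < m) (h2 : m < d) :
    ∃ c s : ℝ, c ^ 2 + s ^ 2 = 1 ∧ c ^ 2 * a + c * s * b + s ^ 2 * d = m := by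
  let f : ℝ → ℝ := fun t =>
    Real.cos t ^ 2 * a + Real.cos t * Real.sin t * b + Real.sin t ^ 2 * d
  have hf : ContinuousOn f (Set.Icc 0 (Real.pi / 2)) := by
    apply Continuous.continuousOn
    fun_prop
  have := intermediate_value_Icc (by positivity) hf
  obtain ⟨t, -, ht⟩ := this (show m ∈ _ by simp [f, h1.le, h2.le])
  exact ⟨Real.cos t, Real.sin t, Real.cos_sq_add_sin_sq t, ht⟩

theorem aux_main {n : ℕ} (m : ℝ) (N : ℕ) : ∀ C : Matrix (Fin n) (Fin n) ℝ,
    C.trace = n * m → (Finset.univ.filter fun k => C k k ≠ m).card ≤ N →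
    ∃ U : Matrix (Fin n) (Fin n) ℝ, Uᵀ * U = 1 ∧ ∀ i, (Uᵀ * C * U) i i = m := by
  induction N with
  | zero =>
    intro C _ h
    refine ⟨1, by simp, fun i => ?_⟩
    simp only [nonpos_iff_eq_zero, Finset.card_eq_zero, Finset.filter_eq_empty_iff] at h
    simpa using h (Finset.mem_univ i)
  | succ N ih =>
    intro C hC h
    by_cases hall : ∀ k, C k k = m
    · exact ⟨1, by simp, by simpa using hall⟩
    push Not at hall
    obtain ⟨k, hk⟩ := hall
    have hsum : ∑ k, (C k k - m) = 0 := by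
      rw [Finset.sum_sub_distrib]
      simp only [Matrix.trace, Matrix.diag] at hC
      simp [hC]
    have hk0 : C k k - m ≠ 0 := sub_ne_zero.mpr hk
    obtain ⟨j, -, hj⟩ := Finset.exists_pos_of_sum_zero_of_exists_nonzero _ hsum
      ⟨k, Finset.mem_univ k, hk0⟩
    have hsum' : ∑ k, (m - C k k) = 0 := by
      rw [← neg_eq_zero, ← Finset.sum_neg_distrib, ← hsum]
      simp
    obtain ⟨i, -, hi⟩ := Finset.exists_pos_of_sum_zero_of_exists_nonzero _ hsum'
      ⟨k, Finset.mem_univ k, sub_ne_zero.mpr hk.symm⟩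
    have hij : i ≠ j := by
      rintro rfl
      linarith
    obtain ⟨c, s, hcs, hv⟩ := aux_ivt (C i i) (C i j + C j i) (C j j) m (by linarith) (by linarith)
    obtain ⟨R, hR, hRC⟩ := aux_rot i j hij c s hcs
    obtain ⟨hii, hkk⟩ := hRC C
    rw [hv] at hii
    obtain ⟨U, hU, hUC⟩ := ih (Rᵀ * C * R) (by
      rw [Matrix.trace_mul_comm, ← Matrix.mul_assoc, mul_eq_one_comm.mp hR, Matrix.one_mul, hC]) (by
      have : (Finset.univ.filter fun k => (Rᵀ * C * R) k k ≠ m) ⊂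
          (Finset.univ.filter fun k => C k k ≠ m) := by
        rw [Finset.ssubset_iff_of_subset]
        · exact ⟨i, by simpa using (by linarith : C i i < m).ne, by simpa using hii⟩
        · intro l hl
          simp only [Finset.mem_filter, Finset.mem_univ, true_and] at hl ⊢
          by_cases hli : l = i
          · subst hli; exact absurd hii hl
          by_cases hlj : l = j
          · subst hlj; exact (by linarith : m < C l l).ne'
          · rwa [hkk l hli hlj] at hl
      have := Finset.card_lt_card this
      omega)
    refine ⟨R * U, ?_, fun l => ?_⟩
    · rw [transpose_mul, Matrix.mul_assoc, ← Matrix.mul_assoc Rᵀ, hR, Matrix.one_mul, hU]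
    · rw [← hUC l]
      simp only [transpose_mul, Matrix.mul_assoc]

theorem exists_orthogonal_equal_diagonal
    (n : ℕ) (hn : 1 ≤ n) (C : Matrix (Fin n) (Fin n) ℝ) (hC : C.IsSymm) :
    ∃ U : Matrix (Fin n) (Fin n) ℝ,
      Uᵀ * U = 1 ∧ ∀ i, (Uᵀ * C * U) i i = C.trace / n := by
  have hn' : (n : ℝ) ≠ 0 := by
    have : n ≠ 0 := by omega
    exact_mod_cast this
  exact aux_main (C.trace / n) _ C (by field_simp) le_rfl
end

section
/- Let n ≥ 2 and let x₁,…,xₙ > 0 satisfy (1/n)·Σᵢ 1/xᵢ = 1. Then (1/n)·Σᵢ xᵢ ≤ Πᵢ xᵢ. -/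
theorem maclaurin_aux (k : ℕ) : ∀ y : Fin (k+1) → ℝ, (∀ i, 0 < y i) → ∀ a : ℝ,
    (∑ i, y i) = (k+1) * a →
    (∏ i, y i) ≤ a^(k+1) ∧ (∏ i, y i) * (∑ i, 1 / y i) ≤ (k+1) * a^k := by
  induction k with
  | zero =>
    intro y hy a h
    have h0 := hy 0
    simp at h ⊢
    exact ⟨h.le, by rw [mul_inv_cancel₀ h0.ne']⟩
  | succ k ih =>
    intro y hy m hm
    rw [Fin.sum_univ_succ] at hm
    rw [Fin.prod_univ_succ, Fin.sum_univ_succ]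
    have ht := hy 0
    have hy' : ∀ i : Fin (k+1), 0 < y i.succ := fun i => hy _
    have hS : 0 < ∑ i : Fin (k+1), y i.succ :=
      Finset.sum_pos (fun i _ => hy' i) Finset.univ_nonempty
    generalize y 0 = t at *
    obtain ⟨a, ha⟩ : ∃ a : ℝ, (∑ i : Fin (k+1), y i.succ) = (k+1) * a :=
      ⟨(∑ i : Fin (k+1), y i.succ) / (k+1), by field_simp⟩
    obtain ⟨h1, h2⟩ := ih (fun i => y i.succ) hy' a ha
    rw [ha] at hm hS
    have hk : (0:ℝ) < k + 1 := by positivity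
    have ha0 : 0 < a := by
      rcases lt_or_ge 0 a with h | h
      · exact h
      · nlinarith
    push_cast at hm ⊢
    have hm0 : 0 < m := by
      rcases lt_or_ge 0 m with h | h
      · exact h
      · nlinarith
    have hma : (-2:ℝ) ≤ m / a - 1 := by
      have : 0 < m / a := by positivity
      linarith
    have b1 := one_add_mul_le_pow hma (k+1+1)
    have b2 := one_add_mul_le_pow hma (k+1)
    push_cast at b1 b2
    rw [add_sub_cancel, div_pow, le_div_iff₀ (by positivity)] at b1 b2
    have e1 : (1 + ((k:ℝ)+1+1) * (m/a - 1)) * a^(k+1+1) = t * a^(k+1) := by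
      have ht' : t = (k+1+1) * m - (k+1) * a := by linarith
      subst ht'
      field_simp
      ring
    have e2 : ((k:ℝ)+1+1) * ((1 + ((k:ℝ)+1) * (m/a - 1)) * a^(k+1))
        = a^(k+1) + t * ((k+1) * a^k) := by
      have ht' : t = (k+1+1) * m - (k+1) * a := by linarith
      subst ht'
      field_simp
      ring
    rw [e1] at b1
    constructor
    · exact (mul_le_mul_of_nonneg_left h1 ht.le).trans b1
    · have b3 := mul_le_mul_of_nonneg_left b2 (show (0:ℝ) ≤ k+1+1 by positivity)
      rw [e2] at b3
      refine le_trans (le_of_eq ?_) ((add_le_add h1 (mul_le_mul_of_nonneg_left h2 ht.le)).trans b3)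
      field_simp

theorem am_le_prod_of_harmonic_mean_one
    (n : ℕ) (hn : 2 ≤ n) (x : Fin n → ℝ) (hx : ∀ i, 0 < x i)
    (hharm : (1 / n : ℝ) * ∑ i, 1 / x i = 1) :
    (1 / n : ℝ) * ∑ i, x i ≤ ∏ i, x i := by
  obtain ⟨k, rfl⟩ : ∃ k, n = k + 1 := ⟨n - 1, by omega⟩
  have hk : (0:ℝ) < k + 1 := by positivity
  push_cast at hharm ⊢
  have hs : (∑ i, 1 / x i) = (k+1) * 1 := by
    field_simp at hharm
    simpa using hharm
  have h := (maclaurin_aux k (fun i => 1 / x i) (fun i => one_div_pos.2 (hx i)) 1 hs).2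
  have hP : 0 < ∏ i, x i := Finset.prod_pos fun i _ => hx i
  simp only [one_div, inv_inv, Finset.prod_inv_distrib, one_pow, mul_one] at h
  rw [inv_mul_le_iff₀ hP] at h
  rw [one_div, inv_mul_le_iff₀ hk]
  linarith
end

section
/- Let n ≥ 3 and let x₁,…,xₙ > 0 satisfy (1/n)·Σᵢ 1/xᵢ = 1. Then (1/n)·Σᵢ xᵢ = Πᵢ xᵢ if and only if x₁ = ⋯ = xₙ = 1. -/
lemma aux_le (m u : ℝ) (hm : 0 ≤ m) (hu : 0 ≤ m + u) (k : ℕ) :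
    (m + u) ^ k * (m - k * u) ≤ m ^ (k + 1) := by
  induction k with
  | zero => simp
  | succ k ih =>
    have h : (m + u) ^ (k + 1) * (m - (k + 1 : ℕ) * u)
        = m * ((m + u) ^ k * (m - k * u)) - (m + u) ^ k * ((k + 1) * u ^ 2) := by
      push_cast; ring
    have h1 : 0 ≤ (m + u) ^ k * ((k + 1) * u ^ 2) := by positivity
    have h2 := mul_le_mul_of_nonneg_left ih hm
    rw [h, pow_succ' m (k + 1)]
    linarith

lemma aux_lt (m u : ℝ) (hm : 0 ≤ m) (hu : 0 < m + u) (hne : u ≠ 0) (k : ℕ) :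
    (m + u) ^ (k + 1) * (m - (k + 1 : ℕ) * u) < m ^ (k + 2) := by
  have h : (m + u) ^ (k + 1) * (m - (k + 1 : ℕ) * u)
      = m * ((m + u) ^ k * (m - k * u)) - (m + u) ^ k * ((k + 1) * u ^ 2) := by
    push_cast; ring
  have h1 : 0 < (m + u) ^ k * ((k + 1) * u ^ 2) := by positivity
  have h2 := mul_le_mul_of_nonneg_left (aux_le m u hm hu.le k) hm
  rw [h, pow_succ' m (k + 1)]
  linarith

lemma step_bound (k : ℕ) (P E a t m : ℝ) (ht : 0 < t)
    (hm : (k + 2) * m = (k + 1) * a + t)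
    (hP : P ≤ a ^ (k + 1)) (hE : E ≤ (k + 1) * a ^ k) :
    P + t * E ≤ (k + 2) * ((m + (a - m)) ^ k * (m - k * (a - m))) := by
  have h1 := mul_le_mul_of_nonneg_left hE ht.le
  have h2 : (k + 2) * ((m + (a - m)) ^ k * (m - k * (a - m)))
      = a ^ (k + 1) + t * ((k + 1) * a ^ k) := by
    have : t = (k + 2) * m - (k + 1) * a := by linarith
    rw [this, add_sub_cancel]; ring
  rw [h2]; linarith

lemma maclaurin {ι : Type*} [DecidableEq ι] (y : ι → ℝ) (hy : ∀ i, 0 < y i) (s : Finset ι) :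
    ∀ k : ℕ, s.card = k + 1 → ∀ a : ℝ, (k + 1) * a = ∑ i ∈ s, y i →
      ∏ i ∈ s, y i ≤ a ^ (k + 1) ∧
      (∏ i ∈ s, y i) * ∑ i ∈ s, (y i)⁻¹ ≤ (k + 1) * a ^ k := by
  induction s using Finset.induction_on with
  | empty => intro k hk; simp at hk
  | insert j s hj ih =>
    intro k hk m hm
    rw [Finset.card_insert_of_notMem hj] at hk
    rw [Finset.sum_insert hj] at hm
    rw [Finset.prod_insert hj, Finset.sum_insert hj]
    have hyj := hy j
    rcases k with _ | k
    · have : s = ∅ := by rw [← Finset.card_eq_zero]; omega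
      subst this
      simp at hm ⊢
      exact ⟨hm.ge, by rw [mul_inv_cancel₀ hyj.ne']⟩
    · have hk' : s.card = k + 1 := by omega
      obtain ⟨a, ha⟩ : ∃ a : ℝ, (k + 1) * a = ∑ i ∈ s, y i :=
        ⟨(∑ i ∈ s, y i) / (k + 1), by field_simp⟩
      obtain ⟨h1, h2⟩ := ih k hk' a ha
      have hs : 0 ≤ ∑ i ∈ s, y i := Finset.sum_nonneg fun i _ => (hy i).le
      have ha0 : 0 ≤ a := by
        rw [← ha] at hs; exact nonneg_of_mul_nonneg_right hs (by positivity)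
      push_cast at hm ⊢
      have hm0 : 0 ≤ m := by
        have : 0 ≤ ((k : ℝ) + 1 + 1) * m := by linarith
        exact nonneg_of_mul_nonneg_right this (by positivity)
      have hm' : ((k : ℝ) + 2) * m = (k + 1) * a + y j := by linarith
      have hu : 0 ≤ m + (a - m) := by linarith
      constructor
      · have h3 := aux_le m (a - m) hm0 hu (k + 1)
        have h4 := mul_le_mul_of_nonneg_left h1 hyj.le
        refine (h4.trans (le_of_eq ?_)).trans h3
        have : y j = (k + 2) * m - (k + 1) * a := by linarith
        rw [this, add_sub_cancel]; push_cast; ring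
      · have h3 := aux_le m (a - m) hm0 hu k
        have h4 := step_bound k _ _ a (y j) m hyj hm' h1 h2
        have h5 := mul_le_mul_of_nonneg_left h3 (by positivity : (0 : ℝ) ≤ k + 2)
        calc _ = ∏ i ∈ s, y i + y j * ((∏ i ∈ s, y i) * ∑ i ∈ s, (y i)⁻¹) := by
              field_simp
          _ ≤ _ := h4.trans h5
          _ = _ := by ring

theorem am_eq_prod_iff_of_harmonic_mean_one
    (n : ℕ) (hn : 3 ≤ n) (x : Fin n → ℝ) (hx : ∀ i, 0 < x i)
    (hharm : (1 / n : ℝ) * ∑ i, 1 / x i = 1) :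
    (1 / n : ℝ) * ∑ i, x i = ∏ i, x i ↔ ∀ i, x i = 1 := by
  have hn0 : (n : ℝ) ≠ 0 := by positivity
  constructor
  · intro h j
    obtain ⟨k, rfl⟩ : ∃ k, n = k + 3 := ⟨n - 3, by omega⟩
    set y : Fin (k + 3) → ℝ := fun i => (x i)⁻¹ with hydef
    have hy : ∀ i, 0 < y i := fun i => inv_pos.2 (hx i)
    have hsum : ∑ i, y i = k + 3 := by
      simp only [one_div] at hharm
      rw [inv_mul_eq_iff_eq_mul₀ hn0] at hharm
      simp only [hydef]; rw [hharm]; push_cast; ring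
    have hprod : (∏ i, y i) * ∑ i, (y i)⁻¹ = k + 3 := by
      simp only [hydef, inv_inv, Finset.prod_inv_distrib]
      rw [one_div, inv_mul_eq_iff_eq_mul₀ hn0] at h
      have : ∏ i, x i ≠ 0 := (Finset.prod_pos fun i _ => hx i).ne'
      rw [h]; field_simp; push_cast; ring
    have hj : j ∉ Finset.univ.erase j := by simp
    have hu : insert j (Finset.univ.erase j) = Finset.univ := Finset.insert_erase (Finset.mem_univ j)
    have hcard : (Finset.univ.erase j).card = (k + 1) + 1 := by simp
    rw [← hu, Finset.sum_insert hj] at hsum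
    rw [← hu, Finset.prod_insert hj, Finset.sum_insert hj] at hprod
    generalize Finset.univ.erase j = s at *
    obtain ⟨a, ha⟩ : ∃ a : ℝ, ((k + 1 : ℕ) + 1) * a = ∑ i ∈ s, y i :=
      ⟨(∑ i ∈ s, y i) / ((k + 1 : ℕ) + 1), by field_simp⟩
    obtain ⟨h1, h2⟩ := maclaurin y hy s (k + 1) hcard a ha
    have hs : 0 < ∑ i ∈ s, y i :=
      Finset.sum_pos (fun i _ => hy i) (Finset.card_pos.1 (by omega))
    have ha0 : 0 < a := by
      rw [← ha] at hs; exact pos_of_mul_pos_right hs (by positivity)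
    have hyj := hy j
    have h4 := step_bound (k + 1) _ _ a (y j) 1 hyj
      (by rw [ha]; push_cast; linarith) h1 h2
    have h6 : y j * (∏ i ∈ s, y i) * ((y j)⁻¹ + ∑ i ∈ s, (y i)⁻¹)
        = ∏ i ∈ s, y i + y j * ((∏ i ∈ s, y i) * ∑ i ∈ s, (y i)⁻¹) := by
      field_simp
    have ha1 : a = 1 := by
      by_contra hne
      have h3 := aux_lt 1 (a - 1) zero_le_one (by linarith) (sub_ne_zero.2 hne) k
      have h5 := mul_lt_mul_of_pos_left h3 (by positivity : (0 : ℝ) < (k + 1 : ℕ) + 2)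
      rw [← h6, hprod] at h4
      have := h4.trans_lt h5
      push_cast at this
      rw [one_pow] at this
      linarith
    rw [ha1] at ha
    push_cast at ha
    have : (x j)⁻¹ = 1 := by
      change y j = 1
      linarith
    simpa using this
  · intro h
    simp [h, hn0]
end

section
/- Let n ≥ 2 and let y₁,…,yₙ > 0 satisfy Σᵢ yᵢ = n. Then Σᵢ Π_{j≠i} yⱼ ≤ n, i.e., the elementary symmetric polynomial of degree n−1 in y₁,…,yₙ is at most n. -/
lemma bern_aux (A B : ℝ) (hA : 0 ≤ A) (hB : 0 ≤ B) (n : ℕ) :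
    (n + 1) * (A ^ n * B) ≤ B ^ (n + 1) + n * A ^ (n + 1) := by
  induction n with
  | zero => simp
  | succ n ih =>
    have h1 := mul_le_mul_of_nonneg_left ih hA
    have h2 : 0 ≤ (A - B) * (A ^ (n + 1) - B ^ (n + 1)) := by
      rcases le_total A B with h | h
      · have := pow_le_pow_left₀ hA h (n + 1)
        exact mul_nonneg_of_nonpos_of_nonpos (by linarith) (by linarith)
      · have := pow_le_pow_left₀ hB h (n + 1)
        exact mul_nonneg (by linarith) (by linarith)
    push_cast
    ring_nf at h1 h2 ⊢
    linarith

lemma main_aux (n : ℕ) : ∀ (A : ℝ) (y : Fin (n + 1) → ℝ), (∀ i, 0 < y i) →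
    ∑ i, y i = (n + 1) * A →
    ∏ i, y i ≤ A ^ (n + 1) ∧ (∏ i, y i) * ∑ i, (y i)⁻¹ ≤ (n + 1) * A ^ n := by
  induction n with
  | zero =>
    intro A y hy hs
    have h0 := (hy 0).ne'
    simp at hs
    simp [← hs, h0]
  | succ n ih =>
    intro B y hy hs
    rw [Fin.sum_univ_succ] at hs
    rw [Fin.prod_univ_succ, Fin.sum_univ_succ]
    have hn : (0 : ℝ) < n + 1 := by positivity
    have hSp : 0 < ∑ i : Fin (n + 1), y i.succ :=
      Finset.sum_pos (fun i _ => hy _) Finset.univ_nonempty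
    obtain ⟨A, hA⟩ : ∃ A : ℝ, ∑ i : Fin (n + 1), y i.succ = (n + 1) * A :=
      ⟨(∑ i : Fin (n + 1), y i.succ) / (n + 1), by field_simp⟩
    have hA0 : 0 < A := by
      rw [hA] at hSp
      exact pos_of_mul_pos_right hSp hn.le
    obtain ⟨h1, h2⟩ := ih A (fun i => y i.succ) (fun i => hy _) hA
    have hx := hy 0
    have hP : 0 < ∏ i : Fin (n + 1), y i.succ := Finset.prod_pos fun i _ => hy _
    generalize (∏ i : Fin (n + 1), y i.succ) = P at *
    generalize (∑ i : Fin (n + 1), (y i.succ)⁻¹) = T at *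
    rw [hA] at hs
    generalize y 0 = x at *
    push_cast at hs ⊢
    have hB0 : 0 < B := by
      have : 0 < ((n : ℝ) + 1 + 1) * B := by rw [← hs]; positivity
      exact pos_of_mul_pos_right this (by positivity)
    have hxe : x = (n + 1 + 1) * B - (n + 1) * A := by linarith
    constructor
    · have b := bern_aux A B hA0.le hB0.le (n + 1)
      have := mul_le_mul_of_nonneg_left h1 hx.le
      refine this.trans ?_
      rw [hxe]
      push_cast at b
      ring_nf at b ⊢
      linarith
    · have b := bern_aux A B hA0.le hB0.le n
      have h3 := mul_le_mul_of_nonneg_left h2 hx.le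
      have e : x * P * (x⁻¹ + T) = P + x * (P * T) := by field_simp
      rw [e]
      have h4 : P + x * (P * T) ≤ A ^ (n + 1) + x * ((n + 1) * A ^ n) := by linarith
      refine h4.trans ?_
      rw [hxe]
      have b' := mul_le_mul_of_nonneg_left b (by positivity : (0 : ℝ) ≤ n + 1 + 1)
      ring_nf at b' ⊢
      linarith

theorem esymm_n_sub_one_le_n
    (n : ℕ) (hn : 2 ≤ n) (y : Fin n → ℝ) (hy : ∀ i, 0 < y i)
    (hsum : ∑ i, y i = n) :
    ∑ i, ∏ j ∈ Finset.univ.erase i, y j ≤ n := by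
  obtain ⟨m, rfl⟩ : ∃ m, n = m + 1 := ⟨n - 1, by omega⟩
  have h := (main_aux m 1 y hy (by rw [hsum]; push_cast; ring)).2
  rw [Finset.mul_sum] at h
  have e : ∀ i, ∏ j ∈ Finset.univ.erase i, y j = (∏ j, y j) * (y i)⁻¹ := fun i => by
    rw [← Finset.prod_erase_mul _ _ (Finset.mem_univ i), mul_assoc,
      mul_inv_cancel₀ (hy i).ne', mul_one]
  simp only [e]
  push_cast
  simpa using h
end

section
/- Let A be a symmetric positive definite 2×2 real matrix and let y₀ ∈ ℝ² be a unit vector. Then there exist an orthonormal basis u₁,u₂ of ℝ² with βᵢ := ⟨uᵢ, y₀⟩ > 0 such that 4·√(det A)·(β₁β₂)·(√(u₁ᵀ A⁻¹ u₁)/β₁ + √(u₂ᵀ A⁻¹ u₂)/β₂) = 4·√(det A)·√(tr A⁻¹). -/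
open Matrix

theorem aux_exists_angle (B : Matrix (Fin 2) (Fin 2) ℝ)
    (hB : ∀ x y : ℝ, x ^ 2 + y ^ 2 = 1 →
      0 < x * (B 0 0 * x + B 0 1 * y) + y * (B 1 0 * x + B 1 1 * y))
    (p q : ℝ) (hpq : p ^ 2 + q ^ 2 = 1) :
    ∃ c s : ℝ, 0 < c ∧ 0 < s ∧ c ^ 2 + s ^ 2 = 1 ∧
      c ^ 2 * ((c * p + s * q) * (B 0 0 * (c * p + s * q) + B 0 1 * (c * q - s * p)) +
        (c * q - s * p) * (B 1 0 * (c * p + s * q) + B 1 1 * (c * q - s * p))) =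
      s ^ 2 * ((s * p - c * q) * (B 0 0 * (s * p - c * q) + B 0 1 * (s * q + c * p)) +
        (s * q + c * p) * (B 1 0 * (s * p - c * q) + B 1 1 * (s * q + c * p))) := by
  have key : ∃ t ∈ Set.Ioo (0 : ℝ) (Real.pi / 2), (fun t : ℝ =>
      (Real.sin t) ^ 2 * ((Real.sin t * p - Real.cos t * q) * (B 0 0 * (Real.sin t * p - Real.cos t * q) + B 0 1 * (Real.sin t * q + Real.cos t * p)) +
        (Real.sin t * q + Real.cos t * p) * (B 1 0 * (Real.sin t * p - Real.cos t * q) + B 1 1 * (Real.sin t * q + Real.cos t * p))) -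
      (Real.cos t) ^ 2 * ((Real.cos t * p + Real.sin t * q) * (B 0 0 * (Real.cos t * p + Real.sin t * q) + B 0 1 * (Real.cos t * q - Real.sin t * p)) +
        (Real.cos t * q - Real.sin t * p) * (B 1 0 * (Real.cos t * p + Real.sin t * q) + B 1 1 * (Real.cos t * q - Real.sin t * p)))) t = 0 := by
    have h := hB p q hpq
    refine intermediate_value_Ioo (by positivity) (by fun_prop) ⟨?_, ?_⟩
    · simp
      linarith
    · simp
      linarith
  obtain ⟨t, ⟨h0, h1⟩, ht⟩ := key
  refine ⟨Real.cos t, Real.sin t, Real.cos_pos_of_mem_Ioo ⟨by linarith, h1⟩,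
    Real.sin_pos_of_pos_of_lt_pi h0 (by linarith [Real.pi_pos]), Real.cos_sq_add_sin_sq t, ?_⟩
  simp only at ht
  linarith

theorem planar_vertex_constrained_facet_area_attained
    (A : Matrix (Fin 2) (Fin 2) ℝ) (hA : A.PosDef)
    (y₀ : Fin 2 → ℝ) (hy₀ : y₀ ⬝ᵥ y₀ = 1) :
    ∃ u : Fin 2 → Fin 2 → ℝ,
      (∀ i j, u i ⬝ᵥ u j = if i = j then 1 else 0) ∧
      (∀ i, 0 < u i ⬝ᵥ y₀) ∧
      4 * Real.sqrt A.det * ((u 0 ⬝ᵥ y₀) * (u 1 ⬝ᵥ y₀)) *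
          (Real.sqrt (u 0 ⬝ᵥ A⁻¹.mulVec (u 0)) / (u 0 ⬝ᵥ y₀) +
            Real.sqrt (u 1 ⬝ᵥ A⁻¹.mulVec (u 1)) / (u 1 ⬝ᵥ y₀)) =
        4 * Real.sqrt A.det * Real.sqrt A⁻¹.trace := by
  have hBp : (A⁻¹).PosDef := hA.inv
  generalize A⁻¹ = B at hBp ⊢
  have hB : ∀ x y : ℝ, x ^ 2 + y ^ 2 = 1 →
      0 < x * (B 0 0 * x + B 0 1 * y) + y * (B 1 0 * x + B 1 1 * y) := by
    intro x y hxy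
    have hne : (![x, y] : Fin 2 → ℝ) ≠ 0 := by
      intro h
      have h0 := congrFun h 0
      have h1 := congrFun h 1
      simp at h0 h1
      simp [h0, h1] at hxy
    have := hBp.dotProduct_mulVec_pos hne
    simpa [dotProduct, mulVec, Fin.sum_univ_two] using this
  have hpq : y₀ 0 ^ 2 + y₀ 1 ^ 2 = 1 := by
    simp [dotProduct, Fin.sum_univ_two] at hy₀
    linarith
  obtain ⟨c, s, hc, hs, hcs, he⟩ := aux_exists_angle B hB _ _ hpq
  generalize hp : y₀ 0 = p at *
  generalize hq : y₀ 1 = q at *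
  have e0 : (![c * p + s * q, c * q - s * p] : Fin 2 → ℝ) ⬝ᵥ y₀ = c := by
    simp [dotProduct, Fin.sum_univ_two, hp, hq]
    linear_combination c * hpq
  have e1 : (![s * p - c * q, s * q + c * p] : Fin 2 → ℝ) ⬝ᵥ y₀ = s := by
    simp [dotProduct, Fin.sum_univ_two, hp, hq]
    linear_combination s * hpq
  refine ⟨![![c * p + s * q, c * q - s * p], ![s * p - c * q, s * q + c * p]], ?_, ?_, ?_⟩
  · have hh : (c ^ 2 + s ^ 2) * (p ^ 2 + q ^ 2) = 1 := by rw [hcs, hpq, one_mul]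
    intro i j
    fin_cases i <;> fin_cases j <;> simp [dotProduct, Fin.sum_univ_two]
    · linear_combination hh
    · ring
    · ring
    · linear_combination hh
  · intro i
    fin_cases i
    · exact e0.symm ▸ hc
    · exact e1.symm ▸ hs
  · simp only [Matrix.cons_val_zero, Matrix.cons_val_one, e0, e1]
    have f0 : (![c * p + s * q, c * q - s * p] : Fin 2 → ℝ) ⬝ᵥ B.mulVec ![c * p + s * q, c * q - s * p] =
      (c * p + s * q) * (B 0 0 * (c * p + s * q) + B 0 1 * (c * q - s * p)) +
        (c * q - s * p) * (B 1 0 * (c * p + s * q) + B 1 1 * (c * q - s * p)) := by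
      simp [dotProduct, mulVec, Fin.sum_univ_two]
    have f1 : (![s * p - c * q, s * q + c * p] : Fin 2 → ℝ) ⬝ᵥ B.mulVec ![s * p - c * q, s * q + c * p] =
      (s * p - c * q) * (B 0 0 * (s * p - c * q) + B 0 1 * (s * q + c * p)) +
        (s * q + c * p) * (B 1 0 * (s * p - c * q) + B 1 1 * (s * q + c * p)) := by
      simp [dotProduct, mulVec, Fin.sum_univ_two]
    rw [f0, f1]
    have hh : (c ^ 2 + s ^ 2) * (p ^ 2 + q ^ 2) = 1 := by rw [hcs, hpq, one_mul]
    have p0 := hB (c * p + s * q) (c * q - s * p) (by linear_combination hh)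
    have htr : B.trace = ((c * p + s * q) * (B 0 0 * (c * p + s * q) + B 0 1 * (c * q - s * p)) +
        (c * q - s * p) * (B 1 0 * (c * p + s * q) + B 1 1 * (c * q - s * p))) +
        ((s * p - c * q) * (B 0 0 * (s * p - c * q) + B 0 1 * (s * q + c * p)) +
        (s * q + c * p) * (B 1 0 * (s * p - c * q) + B 1 1 * (s * q + c * p))) := by
      rw [Matrix.trace_fin_two]
      linear_combination (-(B 0 0 + B 1 1)) * hh
    rw [htr]
    generalize (c * p + s * q) * (B 0 0 * (c * p + s * q) + B 0 1 * (c * q - s * p)) +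
        (c * q - s * p) * (B 1 0 * (c * p + s * q) + B 1 1 * (c * q - s * p)) = a at *
    generalize (s * p - c * q) * (B 0 0 * (s * p - c * q) + B 0 1 * (s * q + c * p)) +
        (s * q + c * p) * (B 1 0 * (s * p - c * q) + B 1 1 * (s * q + c * p)) = b at *
    obtain ⟨t, ht, hta⟩ : ∃ t : ℝ, 0 ≤ t ∧ a = (t * s) ^ 2 := by
      refine ⟨Real.sqrt a / s, by positivity, ?_⟩
      rw [div_mul_cancel₀ _ hs.ne', Real.sq_sqrt p0.le]
    have htb : b = (t * c) ^ 2 := by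
      have : s ^ 2 * b = s ^ 2 * (t * c) ^ 2 := by rw [← he, hta]; ring
      exact mul_left_cancel₀ (by positivity) this
    have hab : a + b = t ^ 2 := by rw [hta, htb]; linear_combination t ^ 2 * hcs
    rw [hab, hta, htb, Real.sqrt_sq (by positivity), Real.sqrt_sq (by positivity),
      Real.sqrt_sq ht]
    field_simp
    linear_combination (Real.sqrt A.det * t) * hcs
end
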